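/- Let G be a finite top p-group such that Z(G) and G/G' are elementary abelian. Then G is the direct product of a special p-group and an elementary abelian p-group. -/

import Mathlib

def IsTopGroup (G : Type*) [Group G] : Prop :=
  ∀ H : Subgroup G, H ≠ ⊤ →
    Nat.card (Abelianization H) < Nat.card (Abelianization G)

/-- A finite `p`-group `P` is special if `P' = Z(P) = Φ(P)`. -/
def IsSpecial (P : Type*) [Group P] : Prop :=
  commutator P = Subgroup.center P ∧ commutator P = frattini P

universe u

open scoped commutatorElement

open Subgroup in
theorem top_quotient {G : Type*} [Group G] [Finite G] (hG : IsTopGroup G)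
    (N : Subgroup G) [N.Normal] (hN : N ≤ commutator G) : IsTopGroup (G ⧸ N) := by
  intro H hH
  have hne : H.comap (QuotientGroup.mk' N) ≠ ⊤ := by
    intro h
    apply hH
    rw [← Subgroup.map_comap_eq_self_of_surjective (QuotientGroup.mk'_surjective N) H, h,
      Subgroup.map_top_of_surjective _ (QuotientGroup.mk'_surjective N)]
  have h1 := hG _ hne
  have h2 : Nat.card (Abelianization H) ≤
      Nat.card (Abelianization (H.comap (QuotientGroup.mk' N))) := by
    refine Nat.card_le_card_of_surjective
      (Abelianization.map ((QuotientGroup.mk' N).subgroupComap H)) ?_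
    intro x
    obtain ⟨y, rfl⟩ := QuotientGroup.mk_surjective x
    obtain ⟨z, hz⟩ := MonoidHom.subgroupComap_surjective_of_surjective (QuotientGroup.mk' N) H
      (QuotientGroup.mk'_surjective N) y
    exact ⟨Abelianization.of z, by rw [Abelianization.map_of, hz]; rfl⟩
  have h3 : Nat.card (Abelianization G) ≤ Nat.card (Abelianization (G ⧸ N)) := by
    refine Nat.card_le_card_of_surjective
      (Abelianization.lift (QuotientGroup.lift N (Abelianization.of (G := G)) ?_)) ?_
    · intro x hx
      have := hN hx
      rwa [← Abelianization.ker_of] at this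
    · intro x
      obtain ⟨y, rfl⟩ := QuotientGroup.mk_surjective x
      exact ⟨Abelianization.of (QuotientGroup.mk y), by rw [Abelianization.lift_apply_of]; rfl⟩
  omega

theorem card_char_le (Q : Type*) [Group Q] [Finite Q] :
    Finite (Q →* ℂˣ) ∧ Nat.card (Q →* ℂˣ) ≤ Nat.card Q := by
  have : Finite (Abelianization Q) := Quotient.finite _
  have e := Nat.card_congr (Abelianization.lift (G := Q) (A := ℂˣ))
  rw [CommGroup.card_monoidHom_of_hasEnoughRootsOfUnity] at e
  have h1 : Nat.card (Abelianization Q) ≤ Nat.card Q :=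
    Nat.card_le_card_of_surjective _ (QuotientGroup.mk_surjective (s := commutator Q))
  refine ⟨Nat.finite_of_card_ne_zero ?_, e.trans_le h1⟩
  rw [e]
  exact Nat.card_pos.ne'

theorem top_core {p : ℕ} (hp : p.Prime) {G : Type*} [Group G] [Finite G] (hG : IsTopGroup G)
    (z : G) (hz : z ∈ Subgroup.center G) (hzp : orderOf z = p)
    (h3 : ⁅commutator G, (⊤ : Subgroup G)⁆ ≤ Subgroup.zpowers z) :
    ⁅commutator G, (⊤ : Subgroup G)⁆ = ⊥ := by
  classical
  by_contra hne
  have hNZ : Subgroup.zpowers z ≤ Subgroup.center G := by simpa using hz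
  obtain ⟨χ, hχ⟩ : ∃ χ : Subgroup.zpowers z →* ℂˣ, Function.Injective χ := by
    have : Fact p.Prime := ⟨hp⟩
    have : Fact (Nat.card (Subgroup.zpowers z)).Prime := ⟨by rwa [Nat.card_zpowers, hzp]⟩
    have hz1 : (⟨z, Subgroup.mem_zpowers z⟩ : Subgroup.zpowers z) ≠ 1 := by
      intro h
      have : z = 1 := congrArg Subtype.val h
      rw [this, orderOf_one] at hzp
      exact hp.one_lt.ne hzp
    let _ : CommGroup (Subgroup.zpowers z) :=
      { (inferInstance : Group (Subgroup.zpowers z)) with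
        mul_comm := fun a b => Subtype.ext (Subgroup.mem_center_iff.1 (hNZ b.2) a) }
    obtain ⟨χ, h⟩ := CommGroup.exists_apply_ne_one_of_hasEnoughRootsOfUnity
      (Subgroup.zpowers z) ℂ hz1
    refine ⟨χ, ?_⟩
    rw [← MonoidHom.ker_eq_bot_iff]
    have : IsSimpleGroup (Subgroup.zpowers z) := isSimpleGroup_of_prime_card rfl
    rcases Subgroup.Normal.eq_bot_or_eq_top (inferInstance : χ.ker.Normal) with h' | h'
    · exact h'
    · exact absurd (show _ ∈ χ.ker by rw [h']; trivial) h
  have hmem : ∀ h ∈ commutator G, ∀ g : G, ⁅h, g⁆ ∈ Subgroup.zpowers z := fun h hh g =>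
    h3 (Subgroup.commutator_mem_commutator hh (Subgroup.mem_top g))
  have hcen : ∀ h ∈ commutator G, ∀ g x : G, x * ⁅h, g⁆ = ⁅h, g⁆ * x := fun h hh g x =>
    Subgroup.mem_center_iff.1 (hNZ (hmem h hh g)) x
  let K : Subgroup (commutator G) := (Subgroup.center G).subgroupOf (commutator G)
  let φ : G → ((commutator G) →* ℂˣ) := fun g =>
    { toFun := fun h => χ ⟨⁅(h : G), g⁆, hmem h h.2 g⟩
      map_one' := by
        rw [← map_one χ]; congr 1; ext; simp
      map_mul' := by
        intro a b
        rw [← map_mul]; congr 1; ext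
        have h1 := hcen b b.2 g a
        change ⁅(a : G) * b, g⁆ = ⁅(a : G), g⁆ * ⁅(b : G), g⁆
        have h2 : ⁅(a : G) * b, g⁆ = a * ⁅(b : G), g⁆ * (a : G)⁻¹ * ⁅(a : G), g⁆ := by
          simp only [commutatorElement_def]; group
        rw [h2, h1, mul_inv_cancel_right, hcen a a.2] }
  have hφ : ∀ g, ∀ h : commutator G, φ g h = χ ⟨⁅(h : G), g⁆, hmem h h.2 g⟩ := fun _ _ => rfl
  let Φ : G →* ((commutator G ⧸ K) →* ℂˣ) :=
    { toFun := fun g => QuotientGroup.lift K (φ g) (by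
        intro x hx
        have hx' : (x : G) ∈ Subgroup.center G := hx
        rw [MonoidHom.mem_ker, hφ, ← map_one χ]; congr 1; ext
        change ⁅(x : G), g⁆ = 1
        rw [commutatorElement_eq_one_iff_mul_comm]
        exact (Subgroup.mem_center_iff.1 hx' g).symm)
      map_one' := by
        ext y
        change ((χ _ : ℂˣ) : ℂ) = ((1 : ℂˣ) : ℂ)
        rw [← map_one χ]; congr 2; ext; simp
      map_mul' := by
        intro a b
        ext y
        change ((χ _ : ℂˣ) : ℂ) = ((χ _ * χ _ : ℂˣ) : ℂ)
        rw [← map_mul]; congr 2; ext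
        change ⁅(y : G), a * b⁆ = ⁅(y : G), a⁆ * ⁅(y : G), b⁆
        have h1 := hcen y y.2 b a
        have h2 : ⁅(y : G), a * b⁆ = ⁅(y : G), a⁆ * (a * ⁅(y : G), b⁆ * a⁻¹) := by
          simp only [commutatorElement_def]; group
        rw [h2, h1, mul_inv_cancel_right] }
  let C : Subgroup G := Subgroup.centralizer (commutator G : Set G)
  have hker : Φ.ker ≤ C := by
    intro g hg
    rw [Subgroup.mem_centralizer_iff]
    intro h hh
    have h1 : Φ g (QuotientGroup.mk ⟨h, hh⟩) = 1 := by
      rw [MonoidHom.mem_ker.1 hg]; rfl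
    have h2 : χ ⟨⁅h, g⁆, hmem h hh g⟩ = χ 1 := by rw [map_one]; exact h1
    have h3 := congrArg Subtype.val (hχ h2)
    exact commutatorElement_eq_one_iff_mul_comm.1 h3
  obtain ⟨hf, hc⟩ := card_char_le (commutator G ⧸ K)
  have hidx : C.index ≤ K.index := by
    calc C.index ≤ Φ.ker.index := Nat.le_of_dvd
          (Nat.pos_of_ne_zero Subgroup.index_ne_zero_of_finite) (Subgroup.index_dvd_of_le hker)
      _ = Nat.card Φ.range := Subgroup.index_ker Φ
      _ ≤ Nat.card ((commutator G ⧸ K) →* ℂˣ) :=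
          Nat.card_le_card_of_injective _ Subtype.val_injective
      _ ≤ _ := hc
  have hCtop : C ≠ ⊤ := by
    intro h
    apply hne
    rw [Subgroup.commutator_comm, Subgroup.commutator_eq_bot_iff_le_centralizer]
    exact h.ge
  have hCC : ⁅C, commutator G⁆ = ⊥ := Subgroup.commutator_eq_bot_iff_le_centralizer.2 le_rfl
  have hC' : ⁅C, C⁆ ≤ Subgroup.center G := by
    have : ⁅⁅C, C⁆, (⊤ : Subgroup G)⁆ = ⊥ := by
      apply Subgroup.commutator_commutator_eq_bot_of_rotate
      · rw [eq_bot_iff, ← hCC, Subgroup.commutator_comm]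
        exact Subgroup.commutator_mono le_rfl (Subgroup.commutator_mono le_top le_top)
      · rw [eq_bot_iff, ← hCC, Subgroup.commutator_comm]
        exact Subgroup.commutator_mono le_rfl (Subgroup.commutator_mono le_top le_top)
    rw [Subgroup.commutator_eq_bot_iff_le_centralizer] at this
    simpa [Subgroup.centralizer_univ] using this
  have hC'K : Nat.card (commutator C) ≤ Nat.card K := by
    have hm : ∀ x : C, x ∈ commutator C → (x : G) ∈ ⁅C, C⁆ := by
      intro x hx
      have : (commutator C).map C.subtype = ⁅C, C⁆ := by
        rw [commutator_def, Subgroup.map_commutator, ← MonoidHom.range_eq_map,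
          Subgroup.range_subtype]
      rw [← this]
      exact ⟨x, hx, rfl⟩
    refine Nat.card_le_card_of_injective (fun x : commutator C =>
      (⟨⟨(x : C), Subgroup.commutator_mono le_top le_top (hm x x.2)⟩, hC' (hm x x.2)⟩ : K)) ?_
    intro x y hxy
    apply Subtype.ext
    apply Subtype.ext
    exact congrArg (fun t : K => ((t : commutator G) : G)) hxy
  have e1 := Subgroup.card_mul_index C
  have e2 := Subgroup.card_mul_index (commutator G)
  have e3 := Subgroup.card_mul_index K
  have e4 := Subgroup.card_mul_index (commutator C)
  have h5 : (commutator C).index < (commutator G).index := hG C hCtop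
  have hpos : 0 < Nat.card K * K.index := by
    rw [e3]; exact Nat.card_pos
  have : (commutator G).index * (Nat.card K * K.index) ≤
      (commutator C).index * (Nat.card K * K.index) := by
    calc (commutator G).index * (Nat.card K * K.index)
        = Nat.card (commutator C) * (commutator C).index * C.index := by
          rw [e3, e4, e1, ← e2, mul_comm]
      _ ≤ Nat.card K * (commutator C).index * K.index := by gcongr
      _ = _ := by ring
  have := Nat.le_of_mul_le_mul_right this hpos
  omega

theorem top_class_two {p : ℕ} (hp : p.Prime) (n : ℕ) : ∀ (G : Type u) [Group G] [Finite G],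
    Nat.card G ≤ n → IsPGroup p G → IsTopGroup G → ⁅commutator G, (⊤ : Subgroup G)⁆ = ⊥ := by
  have : Fact p.Prime := ⟨hp⟩
  induction n with
  | zero => intro G _ _ h; exact absurd h (by have := Nat.card_pos (α := G); omega)
  | succ n ih =>
    intro G _ _ hn hpG hG
    by_contra hne
    obtain ⟨m, hm⟩ := Subgroup.nilpotent_iff_lowerCentralSeries.1 hpG.isNilpotent
    obtain ⟨N, hN3, hNc, hNb⟩ : ∃ N : Subgroup G, N ≤ ⁅commutator G, (⊤ : Subgroup G)⁆ ∧
        N ≤ Subgroup.center G ∧ N ≠ ⊥ := by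
      classical
      have hex : ∃ m, (⊤ : Subgroup G).lowerCentralSeries m = ⊥ := ⟨m, hm⟩
      have h2 : (⊤ : Subgroup G).lowerCentralSeries 2 = ⁅commutator G, (⊤ : Subgroup G)⁆ := rfl
      have hlt : 2 < Nat.find hex := by
        by_contra hcon
        apply hne
        rw [← h2, eq_bot_iff, ← Nat.find_spec hex]
        exact Subgroup.lowerCentralSeries_antitone _ (by omega)
      obtain ⟨k, hk⟩ : ∃ k, Nat.find hex = k + 1 := ⟨Nat.find hex - 1, by omega⟩
      refine ⟨(⊤ : Subgroup G).lowerCentralSeries k, ?_, ?_, ?_⟩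
      · rw [← h2]
        exact Subgroup.lowerCentralSeries_antitone _ (by omega)
      · have := Nat.find_spec hex
        rw [hk, Subgroup.lowerCentralSeries_succ,
          Subgroup.commutator_eq_bot_iff_le_centralizer] at this
        simpa [Subgroup.centralizer_univ] using this
      · exact Nat.find_min hex (by omega)
    obtain ⟨z, hzN, hz⟩ : ∃ z ∈ N, orderOf z = p := by
      have : Nontrivial N := (Subgroup.nontrivial_iff_ne_bot N).2 hNb
      obtain ⟨j, hj, hc⟩ := (hpG.to_subgroup N).nontrivial_iff_card.1 this
      obtain ⟨z, hz⟩ := exists_prime_orderOf_dvd_card' (G := N) p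
        (by rw [hc]; exact dvd_pow_self p hj.ne')
      exact ⟨z, z.2, by rwa [Subgroup.orderOf_coe]⟩
    have hzc := hNc hzN
    have hZn : (Subgroup.zpowers z).Normal := by
      constructor
      intro x hx g
      have : Subgroup.zpowers z ≤ Subgroup.center G := by simpa using hzc
      rw [Subgroup.mem_center_iff.1 (this hx) g, mul_inv_cancel_right]
      exact hx
    have hZ3 : Subgroup.zpowers z ≤ ⁅commutator G, (⊤ : Subgroup G)⁆ := by
      simpa using hN3 hzN
    have hZ2 : Subgroup.zpowers z ≤ commutator G :=
      hZ3.trans (Subgroup.commutator_mono le_top le_top)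
    have hcard : Nat.card (G ⧸ Subgroup.zpowers z) ≤ n := by
      have e := Subgroup.card_mul_index (Subgroup.zpowers z)
      rw [Nat.card_zpowers, hz, Subgroup.index] at e
      have := hp.two_le
      have h0 := Nat.card_pos (α := G ⧸ Subgroup.zpowers z)
      nlinarith
    have hq := ih (G ⧸ Subgroup.zpowers z) hcard (hpG.to_quotient _) (top_quotient hG _ hZ2)
    apply hne
    refine top_core hp hG z hzc hz ?_
    have hs := Subgroup.map_top_of_surjective _ (QuotientGroup.mk'_surjective (Subgroup.zpowers z))
    have : (⁅commutator G, (⊤ : Subgroup G)⁆).map (QuotientGroup.mk' (Subgroup.zpowers z)) = ⊥ := by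
      rw [commutator_def, Subgroup.map_commutator, Subgroup.map_commutator, hs, ← commutator_def, hq]
    rw [Subgroup.map_eq_bot_iff, QuotientGroup.ker_mk'] at this
    exact this

theorem elem_compl {p : ℕ} (hp : p.Prime) {A : Type*} [CommGroup A] (h : ∀ x : A, x ^ p = 1)
    (H : Subgroup A) : ∃ K : Subgroup A, IsCompl H K := by
  have : Fact p.Prime := ⟨hp⟩
  let _ : Module (ZMod p) (Additive A) := AddCommGroup.zmodModule (n := p) (fun x => h x.toMul)
  let e : Subgroup A ≃o Submodule (ZMod p) (Additive A) :=
    Subgroup.toAddSubgroup.trans (AddSubgroup.toZModSubmodule p)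
  obtain ⟨K, hK⟩ := exists_isCompl (e H)
  refine ⟨e.symm K, ?_⟩
  rw [e.isCompl_iff]
  simpa using hK

theorem comm_le_of_sup_center {G : Type*} [Group G] (P : Subgroup G)
    (h : P ⊔ Subgroup.center G = ⊤) : commutator G ≤ ⁅P, P⁆ := by
  rw [commutator_def, Subgroup.commutator_le]
  intro x _ y _
  obtain ⟨a, ha, u, hu, rfl⟩ := Subgroup.mem_sup_of_normal_right.1 (show x ∈ P ⊔ Subgroup.center G by rw [h]; trivial)
  obtain ⟨b, hb, v, hv, rfl⟩ := Subgroup.mem_sup_of_normal_right.1 (show y ∈ P ⊔ Subgroup.center G by rw [h]; trivial)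
  have hu' := Subgroup.mem_center_iff.1 hu
  have hv' := Subgroup.mem_center_iff.1 hv
  have : ⁅a * u, b * v⁆ = ⁅a, b⁆ := by
    simp only [commutatorElement_def, mul_inv_rev]
    calc a * u * (b * v) * (u⁻¹ * a⁻¹) * (v⁻¹ * b⁻¹)
        = a * (u * (b * v)) * u⁻¹ * a⁻¹ * v⁻¹ * b⁻¹ := by group
      _ = a * b * (v * (a⁻¹ * v⁻¹)) * b⁻¹ := by rw [← hu']; group
      _ = a * b * (a⁻¹ * v⁻¹ * v) * b⁻¹ := by rw [← hv']
      _ = _ := by group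
  rw [this]
  exact Subgroup.commutator_mem_commutator ha hb

theorem frattini_eq {p : ℕ} (hp : p.Prime) {P : Type*} [Group P]
    (h1 : commutator P = Subgroup.center P) (h2 : ∀ x : P, x ^ p ∈ commutator P) :
    commutator P = frattini P := by
  have : Fact p.Prime := ⟨hp⟩
  apply le_antisymm
  · simp only [frattini, Order.radical, le_iInf_iff]
    intro M hM
    by_contra hcon
    have hs : M ⊔ commutator P = ⊤ := by
      apply hM.2
      exact lt_of_le_of_ne le_sup_left (fun h => hcon (h ▸ le_sup_right))
    rw [h1] at hs
    exact hcon ((comm_le_of_sup_center M hs).trans (Subgroup.commutator_le_self M))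
  · have hel : ∀ x : Abelianization P, x ^ p = 1 := by
      intro x
      obtain ⟨y, rfl⟩ := QuotientGroup.mk_surjective x
      change Abelianization.of y ^ p = 1
      rw [← map_pow, ← MonoidHom.mem_ker, Abelianization.ker_of]
      exact h2 y
    intro x hx
    by_contra hxn
    have hx1 : Abelianization.of x ≠ 1 := by
      rwa [Ne, ← MonoidHom.mem_ker, Abelianization.ker_of]
    obtain ⟨K, hK⟩ := elem_compl hp hel (Subgroup.zpowers (Abelianization.of x))
    have ho : orderOf (Abelianization.of x) = p := orderOf_eq_prime (hel _) hx1
    have hat : IsAtom (Subgroup.zpowers (Abelianization.of x)) := by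
      refine ⟨by simpa using hx1, ?_⟩
      intro L hL
      by_contra hLb
      obtain ⟨y, hy, hy1⟩ := Subgroup.ne_bot_iff_exists_ne_one.1 hLb |>.elim
        (fun y hy => (⟨y, y.2, fun h => hy (Subtype.ext h)⟩ : ∃ y, y ∈ L ∧ y ≠ 1))
      apply hL.not_ge
      have hyz := hL.le hy
      have hfin : Finite (Subgroup.zpowers (Abelianization.of x)) := by
        apply Nat.finite_of_card_ne_zero
        rw [Nat.card_zpowers, ho]; exact hp.ne_zero
      have : Subgroup.zpowers y = Subgroup.zpowers (Abelianization.of x) := by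
        apply Subgroup.eq_of_le_of_card_ge (by simpa using hyz)
        rw [Nat.card_zpowers, Nat.card_zpowers, ho, orderOf_eq_prime (hel y) hy1]
      rw [← this]
      simpa using hy
    have hco := hK.isAtom_iff_isCoatom.1 hat
    have hco' := Subgroup.isCoatom_comap_of_surjective
      (φ := (Abelianization.of : P →* _)) (QuotientGroup.mk_surjective) hco
    have hxK : Abelianization.of x ∈ K := frattini_le_coatom hco' hx
    have := hK.disjoint.le_bot ⟨Subgroup.mem_zpowers _, hxK⟩
    exact hx1 (by simpa using this)

theorem top_p_group_structure (p : ℕ) (hp : p.Prime) (G : Type*) [Group G]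
    [Finite G] (hpG : IsPGroup p G) (hG : IsTopGroup G)
    (hZ : ∀ x ∈ Subgroup.center G, x ^ p = 1)
    (hab : ∀ x : Abelianization G, x ^ p = 1) :
    ∃ P A : Subgroup G, P.Normal ∧ A.Normal ∧ P ⊓ A = ⊥ ∧ P ⊔ A = ⊤ ∧
      IsSpecial P ∧ (∀ x ∈ A, ∀ y ∈ A, x * y = y * x) ∧
      (∀ x ∈ A, x ^ p = 1) := by
  have h3 := top_class_two hp _ G le_rfl hpG hG
  have hGZ : commutator G ≤ Subgroup.center G := by
    rw [Subgroup.commutator_eq_bot_iff_le_centralizer] at h3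
    simpa [Subgroup.centralizer_univ] using h3
  have hsurj : Function.Surjective (Abelianization.of : G →* Abelianization G) :=
    QuotientGroup.mk_surjective
  obtain ⟨Pb, hPb⟩ := elem_compl hp hab ((Subgroup.center G).map Abelianization.of)
  let _ : CommGroup (Subgroup.center G) :=
    { (inferInstance : Group (Subgroup.center G)) with
      mul_comm := fun a b => Subtype.ext (Subgroup.mem_center_iff.1 b.2 a) }
  obtain ⟨Ab, hAb⟩ := elem_compl hp (A := Subgroup.center G)
    (fun x => Subtype.ext (hZ x x.2)) ((commutator G).subgroupOf (Subgroup.center G))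
  let P : Subgroup G := Pb.comap Abelianization.of
  let A : Subgroup G := Ab.map (Subgroup.center G).subtype
  have hAZ : A ≤ Subgroup.center G := Subgroup.map_subtype_le _
  have hGP : commutator G ≤ P := by
    intro x hx
    rw [← Abelianization.ker_of, MonoidHom.mem_ker] at hx
    change Abelianization.of x ∈ Pb
    rw [hx]; exact one_mem _
  have hPZ : ∀ x ∈ P, x ∈ Subgroup.center G → x ∈ commutator G := by
    intro x hx hxz
    have := hPb.disjoint.le_bot ⟨⟨x, hxz, rfl⟩, hx⟩
    rwa [Subgroup.mem_bot, ← MonoidHom.mem_ker, Abelianization.ker_of] at this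
  have hPZt : P ⊔ Subgroup.center G = ⊤ := by
    rw [eq_top_iff]
    intro x _
    have hx : Abelianization.of x ∈ (Subgroup.center G).map Abelianization.of ⊔ Pb := by
      rw [hPb.sup_eq_top]; trivial
    obtain ⟨_, ⟨a, ha, rfl⟩, b, hb, hxab⟩ := Subgroup.mem_sup.1 hx
    refine Subgroup.mem_sup_of_normal_right.2 ⟨x * a⁻¹, ?_, a, ha, by group⟩
    change Abelianization.of (x * a⁻¹) ∈ Pb
    rw [map_mul, ← hxab, map_inv, mul_comm _ b, mul_inv_cancel_right]
    exact hb
  have hZle : Subgroup.center G ≤ P ⊔ A := by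
    intro x hx
    obtain ⟨a, ha, b, hb, hxab⟩ := Subgroup.mem_sup.1
      (show (⟨x, hx⟩ : Subgroup.center G) ∈ (commutator G).subgroupOf (Subgroup.center G) ⊔ Ab by
        rw [hAb.sup_eq_top]; trivial)
    have := Subgroup.mul_mem_sup (S := P) (T := A) (hGP ha) ⟨b, hb, rfl⟩
    have e : (a : G) * b = x := congrArg Subtype.val hxab
    rw [← e]
    exact this
  have hPP : ⁅P, P⁆ = commutator G :=
    le_antisymm (Subgroup.commutator_mono le_top le_top) (comm_le_of_sup_center P hPZt)
  have hcomm : ∀ x : P, x ∈ commutator P ↔ (x : G) ∈ commutator G := by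
    intro x
    have : (commutator P).map P.subtype = ⁅P, P⁆ := by
      rw [commutator_def, Subgroup.map_commutator, ← MonoidHom.range_eq_map,
        Subgroup.range_subtype]
    rw [← hPP, ← this]
    constructor
    · exact fun hx => ⟨x, hx, rfl⟩
    · rintro ⟨y, hy, hyx⟩
      rwa [← Subtype.ext (a1 := y) (a2 := x) hyx]
  have hcp : commutator P = Subgroup.center P := by
    ext x
    rw [hcomm]
    constructor
    · intro hx
      rw [Subgroup.mem_center_iff]
      intro y
      exact Subtype.ext (Subgroup.mem_center_iff.1 (hGZ hx) y)
    · intro hx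
      apply hPZ x x.2
      rw [Subgroup.mem_center_iff]
      intro g
      obtain ⟨a, ha, u, hu, rfl⟩ :=
        Subgroup.mem_sup_of_normal_right.1
          (show g ∈ P ⊔ Subgroup.center G by rw [hPZt]; trivial)
      have h1 : a * (x : G) = x * a :=
        congrArg Subtype.val (Subgroup.mem_center_iff.1 hx ⟨a, ha⟩)
      have h2 := Subgroup.mem_center_iff.1 hu x
      rw [mul_assoc, ← h2, ← mul_assoc, h1, mul_assoc]
  refine ⟨P, A, ?_, ?_, ?_, ?_, ⟨hcp, frattini_eq hp hcp ?_⟩, ?_, ?_⟩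
  · infer_instance
  · constructor
    intro x hx g
    rw [Subgroup.mem_center_iff.1 (hAZ hx) g, mul_inv_cancel_right]
    exact hx
  · rw [eq_bot_iff]
    rintro x ⟨hxP, y, hy, rfl⟩
    have := hAb.disjoint.le_bot ⟨(hPZ _ hxP y.2 : _), hy⟩
    rw [Subgroup.mem_bot] at this ⊢
    rw [this]; rfl
  · rw [eq_top_iff, ← hPZt]
    exact sup_le le_sup_left hZle
  · intro x
    rw [hcomm, ← Abelianization.ker_of, MonoidHom.mem_ker]
    simpa using hab (Abelianization.of (x : G))
  · intro x hx y hy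
    exact (Subgroup.mem_center_iff.1 (hAZ hy) x)
  · intro x hx
    exact hZ x (hAZ hx)
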